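/- arXiv:1010.0774 — 2 statements merged into one kernel-verified Lean document; each statement's English description precedes it below -/
import Mathlib

section
/- The function Ω₁(b) = ∫_1^∞ (√u/√(u−1))·(√(u+b)/(u²+b)) du tends to π as b → 0⁺. -/
open Real MeasureTheory Set Filter

theorem hasDerivAt_two_mul_arctan_sqrt_sub_one {u : ℝ} (hu : 1 < u) :
    HasDerivAt (fun u : ℝ => 2 * arctan (√(u - 1))) (1 / (u * √(u - 1))) u := by
  have hpos : 0 < u - 1 := sub_pos.2 hu
  have h := ((((hasDerivAt_id u).sub_const 1).sqrt hpos.ne').arctan).const_mul 2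
  refine h.congr_deriv ?_
  have hs : √(u - 1) ≠ 0 := (Real.sqrt_pos.2 hpos).ne'
  have hu0 : u ≠ 0 := by linarith
  simp only [id, Real.sq_sqrt hpos.le, add_sub_cancel]
  field_simp

theorem continuous_two_mul_arctan_sqrt_sub_one :
    Continuous (fun u : ℝ => 2 * arctan (√(u - 1))) :=
  continuous_const.mul (continuous_arctan.comp (by fun_prop))

theorem tendsto_two_mul_arctan_sqrt_sub_one :
    Tendsto (fun u : ℝ => 2 * arctan (√(u - 1))) atTop (nhds π) := by
  have h : Tendsto (fun u : ℝ => √(u - 1)) atTop atTop :=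
    tendsto_sqrt_atTop.comp (tendsto_atTop_add_const_right _ (-1) tendsto_id)
  have h' := ((tendsto_arctan_atTop.mono_right nhdsWithin_le_nhds).comp h).const_mul 2
  rwa [mul_div_cancel₀ π two_ne_zero] at h'

theorem one_div_mul_sqrt_sub_one_nonneg {u : ℝ} (hu : u ∈ Ioi (1 : ℝ)) :
    0 ≤ 1 / (u * √(u - 1)) := by
  have : 0 < u := one_pos.trans hu
  positivity

theorem integrableOn_one_div_mul_sqrt_sub_one :
    IntegrableOn (fun u : ℝ => 1 / (u * √(u - 1))) (Ioi 1) :=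
  integrableOn_Ioi_deriv_of_nonneg
    continuous_two_mul_arctan_sqrt_sub_one.continuousWithinAt
    (fun _ hu => hasDerivAt_two_mul_arctan_sqrt_sub_one hu)
    (fun _ hu => one_div_mul_sqrt_sub_one_nonneg hu)
    tendsto_two_mul_arctan_sqrt_sub_one

theorem integral_one_div_mul_sqrt_sub_one :
    ∫ u in Ioi (1 : ℝ), 1 / (u * √(u - 1)) = π := by
  rw [integral_Ioi_of_hasDerivAt_of_nonneg
    continuous_two_mul_arctan_sqrt_sub_one.continuousWithinAt
    (fun _ hu => hasDerivAt_two_mul_arctan_sqrt_sub_one hu)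
    (fun _ hu => one_div_mul_sqrt_sub_one_nonneg hu)
    tendsto_two_mul_arctan_sqrt_sub_one]
  simp

theorem sqrt_div_mul_sqrt_div_sq {u : ℝ} (hu : 1 < u) :
    √u / √(u - 1) * (√u / u ^ 2) = 1 / (u * √(u - 1)) := by
  have hu0 : 0 < u := one_pos.trans hu
  have hs : √(u - 1) ≠ 0 := (Real.sqrt_pos.2 (sub_pos.2 hu)).ne'
  rw [div_mul_div_comm, Real.mul_self_sqrt hu0.le]
  field_simp

theorem stmt_12 :
    Tendsto
      (fun b : ℝ => ∫ u in Ioi (1 : ℝ),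
        (Real.sqrt u / Real.sqrt (u - 1)) * (Real.sqrt (u + b) / (u ^ 2 + b)))
      (nhdsWithin 0 (Ioi 0)) (nhds Real.pi) := by
  rw [← integral_one_div_mul_sqrt_sub_one]
  refine tendsto_integral_filter_of_dominated_convergence
    (fun u : ℝ => √2 * (1 / (u * √(u - 1)))) ?_ ?_
    (integrableOn_one_div_mul_sqrt_sub_one.const_mul _) ?_
  · exact Eventually.of_forall fun b => Measurable.aestronglyMeasurable (by fun_prop)
  · filter_upwards [Ioo_mem_nhdsGT (one_pos : (0 : ℝ) < 1)] with b hb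
    filter_upwards [ae_restrict_mem measurableSet_Ioi] with u hu
    have hu1 : (1 : ℝ) < u := hu
    have hu0 : 0 < u := one_pos.trans hu1
    have hb0 : 0 < b := hb.1
    have hsqrt : √(u + b) ≤ √2 * √u := by
      rw [← Real.sqrt_mul zero_le_two]
      exact Real.sqrt_le_sqrt (by linarith [hb.2])
    rw [Real.norm_of_nonneg (by positivity), ← sqrt_div_mul_sqrt_div_sq hu1]
    calc √u / √(u - 1) * (√(u + b) / (u ^ 2 + b))
        ≤ √u / √(u - 1) * (√2 * √u / u ^ 2) := by
          gcongr
          linarith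
      _ = √2 * (√u / √(u - 1) * (√u / u ^ 2)) := by ring
  · filter_upwards [ae_restrict_mem measurableSet_Ioi] with u hu
    have hu1 : (1 : ℝ) < u := hu
    have hu0 : u ^ 2 + 0 ≠ 0 := by positivity
    have hcont : ContinuousAt
        (fun b : ℝ => √u / √(u - 1) * (√(u + b) / (u ^ 2 + b))) 0 := by
      fun_prop (disch := assumption)
    have h := hcont.tendsto
    simp only [add_zero] at h
    rw [sqrt_div_mul_sqrt_div_sq hu1] at h
    exact h.mono_left nhdsWithin_le_nhds
end

section
/- For a > 0, the function Ω(a) = 2a∫_a^∞ u²√(u²+4)/((u⁴+4a²)√(u²−a²)) du satisfies π/2 < Ω(a) for all a > 0, Ω(a) → π/2 as a → 0⁺, and Ω(a) → π as a → ∞. -/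
open Real MeasureTheory Set Filter

noncomputable def heisOmega (a : ℝ) : ℝ :=
  2 * a * ∫ u in Ioi a, u ^ 2 * Real.sqrt (u ^ 2 + 4) /
    ((u ^ 4 + 4 * a ^ 2) * Real.sqrt (u ^ 2 - a ^ 2))

/-- The integrand of `heisOmega (2 * b)` after the substitution `u = 2 * b / sin θ`. -/
noncomputable def heisIntegrand (b θ : ℝ) : ℝ :=
  2 * b * √(b ^ 2 + sin θ ^ 2) / (b ^ 2 + sin θ ^ 4)

lemma image_div_sin_Ioo {a : ℝ} (ha : 0 < a) :
    (fun θ => a / sin θ) '' Ioo 0 (π / 2) = Ioi a := by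
  ext u
  simp only [mem_image, mem_Ioo, mem_Ioi]
  constructor
  · rintro ⟨θ, ⟨h0, h1⟩, rfl⟩
    have hs : 0 < sin θ := sin_pos_of_pos_of_lt_pi h0 (by linarith [pi_pos])
    have hs1 : sin θ < 1 := by
      rw [← sin_pi_div_two]
      exact sin_lt_sin_of_lt_of_le_pi_div_two (by linarith) le_rfl h1
    rw [lt_div_iff₀ hs]
    nlinarith
  · intro hu
    have hu0 : 0 < u := ha.trans hu
    have hlt : a / u < 1 := (div_lt_one hu0).2 hu
    have hpos : 0 < a / u := div_pos ha hu0
    refine ⟨arcsin (a / u), ⟨arcsin_pos.2 hpos, arcsin_lt_pi_div_two.2 hlt⟩, ?_⟩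
    rw [sin_arcsin (by linarith) hlt.le]
    field_simp

lemma injOn_div_sin {a : ℝ} (ha : 0 < a) :
    InjOn (fun θ => a / sin θ) (Ioo 0 (π / 2)) := by
  intro x hx y hy h
  have hsx : 0 < sin x := sin_pos_of_pos_of_lt_pi hx.1 (by linarith [hx.2, pi_pos])
  have hsy : 0 < sin y := sin_pos_of_pos_of_lt_pi hy.1 (by linarith [hy.2, pi_pos])
  refine injOn_sin ⟨by linarith [hx.1, pi_pos], hx.2.le⟩ ⟨by linarith [hy.1, pi_pos], hy.2.le⟩ ?_
  simp only at h
  rw [div_eq_div_iff hsx.ne' hsy.ne'] at h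
  exact (mul_left_cancel₀ ha.ne' h).symm

lemma heisOmega_two_mul {b : ℝ} (hb : 0 < b) :
    heisOmega (2 * b) = ∫ θ in (0)..(π / 2), heisIntegrand b θ := by
  have ha : 0 < 2 * b := by positivity
  have hderiv : ∀ θ ∈ Ioo 0 (π / 2),
      HasDerivWithinAt (fun θ => 2 * b / sin θ) (-(2 * b * cos θ) / sin θ ^ 2)
        (Ioo 0 (π / 2)) θ := by
    intro θ hθ
    have hs : 0 < sin θ := sin_pos_of_pos_of_lt_pi hθ.1 (by linarith [hθ.2, pi_pos])
    refine (((hasDerivAt_const θ (2 * b)).div (hasDerivAt_sin θ) hs.ne').congr_deriv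
      ?_).hasDerivWithinAt
    simp
  unfold heisOmega
  rw [← image_div_sin_Ioo ha, integral_image_eq_integral_abs_deriv_smul measurableSet_Ioo hderiv
    (injOn_div_sin ha), intervalIntegral.integral_of_le (by positivity),
    integral_Ioc_eq_integral_Ioo, ← integral_const_mul]
  refine setIntegral_congr_fun measurableSet_Ioo fun θ hθ => ?_
  have hs : 0 < sin θ := sin_pos_of_pos_of_lt_pi hθ.1 (by linarith [hθ.2, pi_pos])
  have hc : 0 < cos θ := cos_pos_of_mem_Ioo ⟨by linarith [hθ.1, pi_pos], hθ.2⟩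
  have h1 : √((2 * b / sin θ) ^ 2 + 4) = 2 * √(b ^ 2 + sin θ ^ 2) / sin θ := by
    rw [sqrt_eq_iff_mul_self_eq_of_pos (by positivity)]
    field_simp
    rw [sq_sqrt (by positivity)]
    ring
  have h2 : √((2 * b / sin θ) ^ 2 - (2 * b) ^ 2) = 2 * b * cos θ / sin θ := by
    rw [sqrt_eq_iff_mul_self_eq_of_pos (by positivity)]
    field_simp
    linarith [sin_sq_add_cos_sq θ]
  simp only [smul_eq_mul, heisIntegrand]
  rw [h1, h2, abs_div, abs_neg, abs_of_pos (by positivity), abs_of_pos (by positivity)]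
  field_simp
  ring

lemma continuous_heisIntegrand {b : ℝ} (hb : 0 < b) : Continuous (heisIntegrand b) := by
  unfold heisIntegrand
  exact Continuous.div (by fun_prop) (by fun_prop) fun θ => by positivity

lemma integral_deriv_arctan_sin_sq_div {b : ℝ} (hb : 0 < b) :
    ∫ θ in (0)..(π / 2), 2 * b * sin θ * cos θ / (b ^ 2 + sin θ ^ 4) = arctan b⁻¹ := by
  have hd : ∀ θ ∈ uIcc 0 (π / 2), HasDerivAt (fun θ => arctan (sin θ ^ 2 / b))
      (2 * b * sin θ * cos θ / (b ^ 2 + sin θ ^ 4)) θ := by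
    intro θ _
    refine (((hasDerivAt_sin θ).pow 2).div_const b).arctan.congr_deriv ?_
    simp only [Pi.pow_apply, Nat.cast_ofNat, Nat.add_one_sub_one, pow_one]
    field_simp
  rw [intervalIntegral.integral_eq_sub_of_hasDerivAt hd
    (Continuous.intervalIntegrable (Continuous.div (by fun_prop) (by fun_prop)
      fun θ => by positivity) _ _)]
  simp

lemma integral_sin_mul_poly_cos (b : ℝ) :
    ∫ θ in (0)..(π / 2), 2 * b * sin θ * (1 - cos θ) *
      (3 / 4 + 9 / 8 * cos θ ^ 2 + 9 / 8 * cos θ ^ 4) = 81 / 80 * b := by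
  have hd : ∀ θ ∈ uIcc 0 (π / 2), HasDerivAt (fun θ => -(2 * b * (3 / 4 * cos θ -
      3 / 8 * cos θ ^ 2 + 3 / 8 * cos θ ^ 3 - 9 / 32 * cos θ ^ 4 + 9 / 40 * cos θ ^ 5 -
      3 / 16 * cos θ ^ 6)))
      (2 * b * sin θ * (1 - cos θ) * (3 / 4 + 9 / 8 * cos θ ^ 2 + 9 / 8 * cos θ ^ 4)) θ := by
    intro θ _
    have h := hasDerivAt_cos θ
    refine ((((((((h.const_mul (3 / 4)).sub ((h.pow 2).const_mul (3 / 8))).add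
      ((h.pow 3).const_mul (3 / 8))).sub ((h.pow 4).const_mul (9 / 32))).add
      ((h.pow 5).const_mul (9 / 40))).sub ((h.pow 6).const_mul (3 / 16))).const_mul
      (2 * b)).neg).congr_deriv ?_
    norm_num
    ring
  rw [intervalIntegral.integral_eq_sub_of_hasDerivAt hd
    (Continuous.intervalIntegrable (by fun_prop) _ _)]
  simp
  ring

lemma le_heisIntegrand_of_sq_le {b θ : ℝ} (hb : 0 < b) (hb3 : b ^ 2 ≤ 1 / 3)
    (hθ : θ ∈ Icc 0 (π / 2)) :
    2 * b * sin θ * cos θ / (b ^ 2 + sin θ ^ 4) +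
      2 * b * sin θ * (1 - cos θ) * (3 / 4 + 9 / 8 * cos θ ^ 2 + 9 / 8 * cos θ ^ 4) ≤
      heisIntegrand b θ := by
  have hs : 0 ≤ sin θ := sin_nonneg_of_nonneg_of_le_pi hθ.1 (by linarith [hθ.2, pi_pos])
  have hD : 0 < b ^ 2 + sin θ ^ 4 := by positivity
  have hsq : sin θ ≤ √(b ^ 2 + sin θ ^ 2) := le_sqrt_of_sq_le (by nlinarith)
  have hkey : (3 / 4 + 9 / 8 * cos θ ^ 2 + 9 / 8 * cos θ ^ 4) * (b ^ 2 + sin θ ^ 4) ≤ 1 := by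
    have hs4 : sin θ ^ 4 = (1 - cos θ ^ 2) ^ 2 := by rw [← sin_sq]; ring
    have ht : 0 ≤ cos θ ^ 2 := sq_nonneg _
    have ht1 : cos θ ^ 2 ≤ 1 := cos_sq_le_one θ
    have hc4 : cos θ ^ 4 = (cos θ ^ 2) ^ 2 := by ring
    rw [hs4, hc4]
    generalize cos θ ^ 2 = t at ht ht1
    calc (3 / 4 + 9 / 8 * t + 9 / 8 * t ^ 2) * (b ^ 2 + (1 - t) ^ 2)
        ≤ (3 / 4 + 9 / 8 * t + 9 / 8 * t ^ 2) * (1 / 3 + (1 - t) ^ 2) := by gcongr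
      _ = 1 - 9 / 8 * t ^ 3 * (1 - t) := by ring
      _ ≤ 1 := by
        have : 0 ≤ 9 / 8 * t ^ 3 * (1 - t) := by
          have : 0 ≤ 1 - t := by linarith
          positivity
        linarith
  have h1 : 2 * b * sin θ * (1 - cos θ) * (3 / 4 + 9 / 8 * cos θ ^ 2 + 9 / 8 * cos θ ^ 4) ≤
      2 * b * sin θ * (1 - cos θ) / (b ^ 2 + sin θ ^ 4) := by
    rw [le_div_iff₀ hD, mul_assoc]
    refine mul_le_of_le_one_right ?_ hkey
    have : 0 ≤ 1 - cos θ := by linarith [cos_le_one θ]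
    positivity
  calc _ ≤ 2 * b * sin θ * cos θ / (b ^ 2 + sin θ ^ 4) +
        2 * b * sin θ * (1 - cos θ) / (b ^ 2 + sin θ ^ 4) := by gcongr
    _ = 2 * b * sin θ / (b ^ 2 + sin θ ^ 4) := by ring
    _ ≤ heisIntegrand b θ := by unfold heisIntegrand; gcongr

lemma one_lt_heisIntegrand {b : ℝ} (hb : 0 < b) (hb3 : 1 / 3 < b ^ 2) (θ : ℝ) :
    1 < heisIntegrand b θ := by
  have hs : sin θ ^ 2 ≤ 1 := sin_sq_le_one θ
  have hD : 0 < b ^ 2 + sin θ ^ 4 := by positivity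
  have h4 : sin θ ^ 4 ≤ sin θ ^ 2 := by nlinarith [sq_nonneg (sin θ)]
  have hr : √(b ^ 2 + sin θ ^ 2) < 2 * b := by
    rw [sqrt_lt' (by positivity)]
    nlinarith
  have hr0 : 0 < √(b ^ 2 + sin θ ^ 2) := by positivity
  unfold heisIntegrand
  rw [one_lt_div hD]
  nlinarith [mul_self_sqrt (show 0 ≤ b ^ 2 + sin θ ^ 2 by positivity)]

lemma pi_div_two_lt_integral_heisIntegrand {b : ℝ} (hb : 0 < b) :
    π / 2 < ∫ θ in (0)..(π / 2), heisIntegrand b θ := by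
  rcases le_or_gt (b ^ 2) (1 / 3) with h | h
  · have hi1 : IntervalIntegrable (fun θ => 2 * b * sin θ * cos θ / (b ^ 2 + sin θ ^ 4))
        volume 0 (π / 2) :=
      Continuous.intervalIntegrable (Continuous.div (by fun_prop) (by fun_prop)
        fun θ => by positivity) _ _
    have hi2 : IntervalIntegrable (fun θ => 2 * b * sin θ * (1 - cos θ) *
        (3 / 4 + 9 / 8 * cos θ ^ 2 + 9 / 8 * cos θ ^ 4)) volume 0 (π / 2) :=
      Continuous.intervalIntegrable (by fun_prop) _ _
    have hle := intervalIntegral.integral_mono_on (by positivity) (hi1.add hi2)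
      ((continuous_heisIntegrand hb).intervalIntegrable _ _)
      (fun θ hθ => le_heisIntegrand_of_sq_le hb h hθ)
    rw [intervalIntegral.integral_add hi1 hi2, integral_deriv_arctan_sin_sq_div hb,
      integral_sin_mul_poly_cos, arctan_inv_of_pos hb] at hle
    have : arctan b ≤ b := by
      simpa using le_tan (arctan_nonneg.2 hb.le) (arctan_lt_pi_div_two b)
    linarith
  · have := intervalIntegral.integral_lt_integral_of_continuousOn_of_le_of_exists_lt
      (a := 0) (b := π / 2) (f := fun _ => (1 : ℝ)) (by positivity) continuousOn_const
      (continuous_heisIntegrand hb).continuousOn (fun θ _ => (one_lt_heisIntegrand hb h θ).le)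
      ⟨0, ⟨le_rfl, by positivity⟩, one_lt_heisIntegrand hb h 0⟩
    simpa using this

/-- Bounds the excess of `heisIntegrand b` over the derivative of `arctan (sin θ ^ 2 / b)`. -/
noncomputable def heisError (b θ : ℝ) : ℝ :=
  (2 * b ^ 2 + 2 * b * sin θ ^ 3) / (b ^ 2 + sin θ ^ 4)

lemma continuous_heisError {b : ℝ} (hb : 0 < b) : Continuous (heisError b) := by
  unfold heisError
  exact Continuous.div (by fun_prop) (by fun_prop) fun θ => by positivity

lemma heisIntegrand_le {b θ : ℝ} (hb : 0 < b) (hθ : θ ∈ Icc 0 (π / 2)) :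
    heisIntegrand b θ ≤
      2 * b * sin θ * cos θ / (b ^ 2 + sin θ ^ 4) + heisError b θ := by
  have hs : 0 ≤ sin θ := sin_nonneg_of_nonneg_of_le_pi hθ.1 (by linarith [hθ.2, pi_pos])
  have hc : 0 ≤ cos θ := cos_nonneg_of_mem_Icc ⟨by linarith [hθ.1, pi_pos], hθ.2⟩
  have hr : √(b ^ 2 + sin θ ^ 2) ≤ b + sin θ := by
    rw [sqrt_le_left (by positivity)]
    nlinarith [mul_nonneg hb.le hs]
  have hcs : 1 - cos θ ≤ sin θ ^ 2 := by
    rw [sin_sq]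
    nlinarith [cos_le_one θ]
  unfold heisIntegrand heisError
  rw [← add_div]
  gcongr
  have h1 := mul_le_mul_of_nonneg_left hr (show 0 ≤ 2 * b by positivity)
  have h2 := mul_le_mul_of_nonneg_left hcs (show 0 ≤ 2 * b * sin θ by positivity)
  nlinarith

lemma tendsto_integral_heisError :
    Tendsto (fun b => ∫ θ in (0)..(π / 2), heisError b θ) (nhdsWithin 0 (Ioi 0)) (nhds 0) := by
  suffices h : Tendsto (fun b => ∫ θ in (0)..(π / 2), heisError b θ) (nhdsWithin 0 (Ioi 0))
      (nhds (∫ _ in (0)..(π / 2), 0)) by simpa using h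
  refine intervalIntegral.tendsto_integral_filter_of_dominated_convergence (fun _ => 3) ?_ ?_
    intervalIntegrable_const ?_
  · filter_upwards [self_mem_nhdsWithin] with b hb
    exact (continuous_heisError hb).aestronglyMeasurable
  · filter_upwards [self_mem_nhdsWithin] with b hb
    refine Eventually.of_forall fun θ hθ => ?_
    rw [uIoc_of_le (by positivity)] at hθ
    have hb : 0 < b := hb
    have hs : 0 ≤ sin θ := sin_nonneg_of_nonneg_of_le_pi hθ.1.le (by linarith [hθ.2, pi_pos])
    have hnn : 0 ≤ heisError b θ := by unfold heisError; positivity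
    rw [norm_of_nonneg hnn, heisError, div_le_iff₀ (by positivity)]
    have h1 : 2 * b * sin θ ^ 3 ≤ 2 * b * sin θ ^ 2 := by
      have : sin θ ^ 3 ≤ sin θ ^ 2 := pow_le_pow_of_le_one hs (sin_le_one θ) (by norm_num)
      gcongr
    nlinarith [sq_nonneg (b - sin θ ^ 2), sq_nonneg (sin θ ^ 2)]
  · refine Eventually.of_forall fun θ hθ => ?_
    rw [uIoc_of_le (by positivity)] at hθ
    have hs : 0 < sin θ := sin_pos_of_pos_of_lt_pi hθ.1 (by linarith [hθ.2, pi_pos])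
    have hcont : ContinuousAt (fun b => heisError b θ) 0 := by
      unfold heisError
      exact ContinuousAt.div (by fun_prop) (by fun_prop) (by positivity)
    simpa [heisError] using hcont.tendsto.mono_left nhdsWithin_le_nhds

lemma tendsto_integral_heisIntegrand_zero :
    Tendsto (fun b => ∫ θ in (0)..(π / 2), heisIntegrand b θ) (nhdsWithin 0 (Ioi 0))
      (nhds (π / 2)) := by
  have hup := tendsto_integral_heisError.const_add (π / 2)
  rw [add_zero] at hup
  refine tendsto_of_tendsto_of_tendsto_of_le_of_le' tendsto_const_nhds hup ?_ ?_
  · filter_upwards [self_mem_nhdsWithin] with b hb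
    exact (pi_div_two_lt_integral_heisIntegrand hb).le
  · filter_upwards [self_mem_nhdsWithin] with b hb
    have hb : 0 < b := hb
    have hi1 : IntervalIntegrable (fun θ => 2 * b * sin θ * cos θ / (b ^ 2 + sin θ ^ 4))
        volume 0 (π / 2) :=
      Continuous.intervalIntegrable (Continuous.div (by fun_prop) (by fun_prop)
        fun θ => by positivity) _ _
    have hi2 := (continuous_heisError hb).intervalIntegrable (μ := volume) 0 (π / 2)
    have hle := intervalIntegral.integral_mono_on (by positivity)
      ((continuous_heisIntegrand hb).intervalIntegrable _ _) (hi1.add hi2)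
      (fun θ hθ => heisIntegrand_le hb hθ)
    rw [intervalIntegral.integral_add hi1 hi2, integral_deriv_arctan_sin_sq_div hb] at hle
    linarith [arctan_lt_pi_div_two b⁻¹]

lemma tendsto_heisIntegrand_atTop (θ : ℝ) :
    Tendsto (fun b => heisIntegrand b θ) atTop (nhds 2) := by
  have hcont : ContinuousAt
      (fun y : ℝ => 2 * √(1 + y ^ 2 * sin θ ^ 2) / (1 + y ^ 2 * sin θ ^ 4)) 0 :=
    ContinuousAt.div (by fun_prop) (by fun_prop) (by norm_num)
  have h := hcont.tendsto.comp tendsto_inv_atTop_zero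
  simp only [ne_eq, OfNat.ofNat_ne_zero, not_false_eq_true, zero_pow, zero_mul, add_zero,
    sqrt_one, mul_one, div_one] at h
  refine h.congr' ?_
  filter_upwards [eventually_gt_atTop 0] with b hb
  have hr : √(b ^ 2 + sin θ ^ 2) = b * √(1 + b⁻¹ ^ 2 * sin θ ^ 2) := by
    rw [← sqrt_sq hb.le, ← sqrt_mul (sq_nonneg _), sqrt_sq hb.le]
    congr 1
    field_simp
  simp only [Function.comp_apply, heisIntegrand, hr]
  field_simp

lemma tendsto_integral_heisIntegrand_atTop :
    Tendsto (fun b => ∫ θ in (0)..(π / 2), heisIntegrand b θ) atTop (nhds π) := by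
  suffices h : Tendsto (fun b => ∫ θ in (0)..(π / 2), heisIntegrand b θ) atTop
      (nhds (∫ _ in (0)..(π / 2), 2)) by simpa using h
  refine intervalIntegral.tendsto_integral_filter_of_dominated_convergence (fun _ => 4) ?_ ?_
    intervalIntegrable_const (Eventually.of_forall fun θ _ => tendsto_heisIntegrand_atTop θ)
  · filter_upwards [eventually_gt_atTop 0] with b hb
    exact (continuous_heisIntegrand hb).aestronglyMeasurable
  · filter_upwards [eventually_ge_atTop 1] with b hb
    refine Eventually.of_forall fun θ _ => ?_
    have hb0 : 0 < b := by linarith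
    have hnn : 0 ≤ heisIntegrand b θ := by unfold heisIntegrand; positivity
    rw [norm_of_nonneg hnn, heisIntegrand, div_le_iff₀ (by positivity)]
    have hr : √(b ^ 2 + sin θ ^ 2) ≤ 2 * b := by
      rw [sqrt_le_left (by positivity)]
      nlinarith [sin_sq_le_one θ]
    have h4 : 0 ≤ sin θ ^ 4 := by positivity
    nlinarith

lemma heisOmega_eq_integral {a : ℝ} (ha : 0 < a) :
    heisOmega a = ∫ θ in (0)..(π / 2), heisIntegrand (a / 2) θ := by
  rw [← heisOmega_two_mul (half_pos ha), mul_div_cancel₀ a two_ne_zero]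

theorem stmt_19 :
    (∀ a : ℝ, 0 < a → Real.pi / 2 < heisOmega a) ∧
    Tendsto heisOmega (nhdsWithin 0 (Ioi 0)) (nhds (Real.pi / 2)) ∧
    Tendsto heisOmega atTop (nhds Real.pi) := by
  refine ⟨fun a ha => ?_, ?_, ?_⟩
  · rw [heisOmega_eq_integral ha]
    exact pi_div_two_lt_integral_heisIntegrand (half_pos ha)
  · have hhalf : Tendsto (fun a : ℝ => a / 2) (nhdsWithin 0 (Ioi 0)) (nhdsWithin 0 (Ioi 0)) := by
      refine tendsto_nhdsWithin_iff.2 ⟨?_, ?_⟩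
      · have : ContinuousAt (fun a : ℝ => a / 2) 0 := by fun_prop
        simpa using this.tendsto.mono_left nhdsWithin_le_nhds
      · filter_upwards [self_mem_nhdsWithin] with a ha
        exact half_pos (mem_Ioi.1 ha)
    refine (tendsto_integral_heisIntegrand_zero.comp hhalf).congr' ?_
    filter_upwards [self_mem_nhdsWithin] with a ha
    exact (heisOmega_eq_integral ha).symm
  · refine (tendsto_integral_heisIntegrand_atTop.comp
      (tendsto_id.atTop_div_const two_pos)).congr' ?_
    filter_upwards [eventually_gt_atTop 0] with a ha
    exact (heisOmega_eq_integral ha).symm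
end
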